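/- Let Ψ be a real T×P matrix with Ψ'Ψ invertible, Ψ̃ a real R×P matrix with Ψ̃Ψ̃' positive definite, Σ̄ a T×T symmetric positive definite matrix, n a positive integer, V := (1/n)·Ψ̃(Ψ'Ψ)⁻¹Ψ'Σ̄Ψ(Ψ'Ψ)⁻¹Ψ̃' and A := V^{-1/2}. Then for every d ∈ ℝ^T and every g ∈ ℝ^R, ‖A(Ψ̃(Ψ'Ψ)⁻¹Ψ'd − g)‖ ≤ (nT/λ_min(Σ̄))^{1/2} · [ max_{1≤t≤T}|d_t| + ‖g‖·λ_max(Ψ'Ψ/T)^{1/2} / λ_min(Ψ̃Ψ̃')^{1/2} ]. In particular, with d the vector of approximation errors (f − f_{P,0})(X_t) and g = Γ(f − f_{P,0}) satisfying ‖g‖ ≤ C₃|f − f_{P,0}|_s, this yields the bias bound ‖E W_{nT}‖ ≤ (nT/λ_min(Σ̄))^{1/2}[‖f − f_{P,0}‖_∞ + C₃|f − f_{P,0}|_s·λ_max(Ψ'Ψ/T)^{1/2}/λ_min(Ψ̃Ψ̃')^{1/2}] of the asymptotic normality theorem. -/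

import Mathlib

open Matrix
open scoped BigOperators

/-- Smallest eigenvalue of a symmetric matrix, via the Rayleigh quotient
(Courant–Fischer characterization). -/
noncomputable def eigMin {m : Type*} [Fintype m] (M : Matrix m m ℝ) : ℝ :=
  sInf {r : ℝ | ∃ x : m → ℝ, x ⬝ᵥ x = 1 ∧ r = x ⬝ᵥ M.mulVec x}

/-- Largest eigenvalue of a symmetric matrix, via the Rayleigh quotient. -/
noncomputable def eigMax {m : Type*} [Fintype m] (M : Matrix m m ℝ) : ℝ :=
  sSup {r : ℝ | ∃ x : m → ℝ, x ⬝ᵥ x = 1 ∧ r = x ⬝ᵥ M.mulVec x}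

section Rayleigh

variable {m : Type*} [Fintype m]

theorem isCompact_setOf_dotProduct_self_eq_one :
    IsCompact {x : m → ℝ | x ⬝ᵥ x = 1} := by
  refine Metric.isCompact_of_isClosed_isBounded
    (isClosed_eq (by simp only [dotProduct]; fun_prop) continuous_const) ?_
  refine (Metric.isBounded_closedBall (x := (0 : m → ℝ)) (r := 1)).subset fun x hx ↦ ?_
  rw [mem_closedBall_zero_iff, pi_norm_le_iff_of_nonneg zero_le_one]
  intro i
  have h : x i * x i ≤ x ⬝ᵥ x :=
    Finset.single_le_sum (f := fun j ↦ x j * x j) (fun j _ ↦ mul_self_nonneg _) (Finset.mem_univ i)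
  rw [show x ⬝ᵥ x = 1 from hx] at h
  exact abs_le_one_iff_mul_self_le_one.mpr h

theorem isCompact_rayleigh_values (M : Matrix m m ℝ) :
    IsCompact {r : ℝ | ∃ x : m → ℝ, x ⬝ᵥ x = 1 ∧ r = x ⬝ᵥ M.mulVec x} := by
  have hc : Continuous fun x : m → ℝ ↦ x ⬝ᵥ M.mulVec x := by
    simp only [dotProduct, mulVec]; fun_prop
  convert isCompact_setOf_dotProduct_self_eq_one.image hc using 1
  ext r
  simp [eq_comm]

theorem exists_dotProduct_self_eq_one_and_smul (x : m → ℝ) (hx : x ≠ 0) :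
    ∃ y : m → ℝ, y ⬝ᵥ y = 1 ∧ x = √(x ⬝ᵥ x) • y := by
  have h0 : 0 < x ⬝ᵥ x :=
    lt_of_le_of_ne (Finset.sum_nonneg fun i _ ↦ mul_self_nonneg _)
      fun h ↦ hx (dotProduct_self_eq_zero.mp h.symm)
  have h1 := Real.sqrt_pos.mpr h0
  refine ⟨(√(x ⬝ᵥ x))⁻¹ • x, ?_, (smul_inv_smul₀ h1.ne' x).symm⟩
  rw [smul_dotProduct, dotProduct_smul, smul_eq_mul, smul_eq_mul, ← mul_assoc, ← mul_inv,
    Real.mul_self_sqrt h0.le, inv_mul_cancel₀ h0.ne']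

theorem eigMin_mul_dotProduct_self_le (M : Matrix m m ℝ) (x : m → ℝ) :
    eigMin M * (x ⬝ᵥ x) ≤ x ⬝ᵥ M.mulVec x := by
  rcases eq_or_ne x 0 with rfl | hx
  · simp
  obtain ⟨y, hy, hxy⟩ := exists_dotProduct_self_eq_one_and_smul x hx
  have h : eigMin M ≤ y ⬝ᵥ M.mulVec y :=
    csInf_le (isCompact_rayleigh_values M).bddBelow ⟨y, hy, rfl⟩
  generalize √(x ⬝ᵥ x) = c at hxy
  subst hxy
  simp only [mulVec_smul, smul_dotProduct, dotProduct_smul, smul_eq_mul, hy]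
  nlinarith [mul_self_nonneg c]

theorem dotProduct_mulVec_le_eigMax_mul (M : Matrix m m ℝ) (x : m → ℝ) :
    x ⬝ᵥ M.mulVec x ≤ eigMax M * (x ⬝ᵥ x) := by
  rcases eq_or_ne x 0 with rfl | hx
  · simp
  obtain ⟨y, hy, hxy⟩ := exists_dotProduct_self_eq_one_and_smul x hx
  have h : y ⬝ᵥ M.mulVec y ≤ eigMax M :=
    le_csSup (isCompact_rayleigh_values M).bddAbove ⟨y, hy, rfl⟩
  generalize √(x ⬝ᵥ x) = c at hxy
  subst hxy
  simp only [mulVec_smul, smul_dotProduct, dotProduct_smul, smul_eq_mul, hy]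
  nlinarith [mul_self_nonneg c]

theorem Matrix.PosDef.eigMin_pos [Nonempty m] {M : Matrix m m ℝ} (hM : M.PosDef) :
    0 < eigMin M := by
  classical
  obtain ⟨i⟩ := ‹Nonempty m›
  obtain ⟨x, hx, h⟩ := (isCompact_rayleigh_values M).sInf_mem
    ⟨_, Pi.single i 1, by simp, rfl⟩
  have hx0 : x ≠ 0 := by rintro rfl; simp at hx
  have := hM.dotProduct_mulVec_pos hx0
  rw [star_trivial] at this
  rwa [eigMin, h]

end Rayleigh

section DotProduct

variable {m : Type*} [Fintype m]

theorem dotProduct_sq_le (x y : m → ℝ) : (x ⬝ᵥ y) ^ 2 ≤ (x ⬝ᵥ x) * (y ⬝ᵥ y) := by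
  simpa [dotProduct, sq] using Finset.sum_mul_sq_le_sq_mul_sq Finset.univ x y

theorem sqrt_dotProduct_self_sub_le (x y : m → ℝ) :
    √((x - y) ⬝ᵥ (x - y)) ≤ √(x ⬝ᵥ x) + √(y ⬝ᵥ y) := by
  have h := norm_sub_le (WithLp.toLp 2 x) (WithLp.toLp 2 y)
  simpa [EuclideanSpace.norm_eq, dotProduct, sq] using h

theorem dotProduct_self_nonneg (x : m → ℝ) : 0 ≤ x ⬝ᵥ x :=
  Finset.sum_nonneg fun _ _ ↦ mul_self_nonneg _

theorem sqrt_dotProduct_self_le_sqrt_card_mul_iSup (x : m → ℝ) :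
    √(x ⬝ᵥ x) ≤ √(Fintype.card m) * ⨆ i, |x i| := by
  have h (i : m) : |x i| ≤ ⨆ i, |x i| :=
    le_ciSup (f := fun i ↦ |x i|) (Set.finite_range _).bddAbove i
  have h0 : 0 ≤ ⨆ i, |x i| := Real.iSup_nonneg fun _ ↦ abs_nonneg _
  rw [← Real.sqrt_sq h0, ← Real.sqrt_mul (Nat.cast_nonneg _), dotProduct]
  refine Real.sqrt_le_sqrt ((Finset.sum_le_card_nsmul _ _ ((⨆ i, |x i|) ^ 2) fun i _ ↦ ?_).trans_eq
    (by simp))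
  rw [← sq, ← sq_abs]
  gcongr
  exact h i

end DotProduct

theorem mul_le_mul_of_sq_le_mul {l k s p q : ℝ} (hl : 0 < l) (hk : 0 ≤ k) (hs : 0 ≤ s)
    (hq : 0 ≤ q) (hsq : s ^ 2 ≤ p * q) (hp : l * p ≤ k * s) : l * s ≤ k * q := by
  rcases hs.eq_or_lt with rfl | hs
  · simpa using mul_nonneg hk hq
  · refine le_of_mul_le_mul_right ?_ hs
    nlinarith [mul_le_mul_of_nonneg_left hsq hl.le, mul_le_mul_of_nonneg_right hp hq]

section Weighted

variable {t r p : Type*} [Fintype t] [Fintype r] [Fintype p] [DecidableEq r]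

/-- If `A` is an inverse square root of `n⁻¹ C S Cᵀ`, then `A C` has operator norm at most
`(n / λ_min(S))^{1/2}`. -/
theorem sqrt_dotProduct_standardized_le [Nonempty t] {S : Matrix t t ℝ} (hS : S.PosDef)
    (C : Matrix r t ℝ) {A : Matrix r r ℝ} (hA : Aᵀ = A) {n : ℝ} (hn : 0 < n)
    (hAC : n⁻¹ • (C * S * Cᵀ) * (A * A) = 1) (d : t → ℝ) :
    √(A.mulVec (C.mulVec d) ⬝ᵥ A.mulVec (C.mulVec d)) ≤ √(n / eigMin S) * √(d ⬝ᵥ d) := by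
  have hl := hS.eigMin_pos
  set w := A.mulVec (C.mulVec d) with hw
  set q := Cᵀ.mulVec (A.mulVec w) with hq
  have hAVA : A * (n⁻¹ • (C * S * Cᵀ)) * A = 1 := by
    have h := mul_eq_one_comm.mp hAC
    rw [Matrix.mul_assoc] at h
    exact mul_eq_one_comm.mp h
  have hqd : w ⬝ᵥ w = q ⬝ᵥ d := by
    rw [hq, mulVec_transpose, ← dotProduct_mulVec, ← hA, mulVec_transpose, ← dotProduct_mulVec]
  have hqS : q ⬝ᵥ S.mulVec q = n * (w ⬝ᵥ w) := by
    have h : w ⬝ᵥ (A * (n⁻¹ • (C * S * Cᵀ)) * A).mulVec w = w ⬝ᵥ w := by rw [hAVA, one_mulVec]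
    have h' : q ⬝ᵥ S.mulVec q = w ⬝ᵥ (A * (C * S * Cᵀ) * A).mulVec w := by
      conv_lhs => enter [1]; rw [hq, mulVec_transpose]
      rw [← dotProduct_mulVec]
      conv_lhs => enter [1]; rw [← hA, mulVec_transpose]
      rw [← dotProduct_mulVec, hq]
      simp only [mulVec_mulVec, Matrix.mul_assoc]
    rw [Matrix.mul_smul, Matrix.smul_mul, smul_mulVec, dotProduct_smul, ← h', smul_eq_mul] at h
    rw [← h, mul_inv_cancel_left₀ hn.ne']
  have key : eigMin S * (w ⬝ᵥ w) ≤ n * (d ⬝ᵥ d) :=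
    mul_le_mul_of_sq_le_mul hl hn.le (dotProduct_self_nonneg w) (dotProduct_self_nonneg d)
      (hqd ▸ dotProduct_sq_le q d) (hqS ▸ eigMin_mul_dotProduct_self_le S q)
  rw [← Real.sqrt_mul (by positivity), div_mul_eq_mul_div]
  exact Real.sqrt_le_sqrt ((le_div_iff₀' hl).mpr key)

/-- Every `g` is the image under `L (F'F)⁻¹ F'` of a vector of norm at most
`(λ_max(c⁻¹ F'F) c / λ_min(L L'))^{1/2} ‖g‖`. -/
theorem exists_preimage_sieve_functional [Nonempty r] [DecidableEq p] (F : Matrix t p ℝ)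
    (hF : IsUnit (Fᵀ * F).det) {L : Matrix r p ℝ} (hL : (L * Lᵀ).PosDef) {c : ℝ} (hc : 0 < c)
    (g : r → ℝ) :
    ∃ e : t → ℝ, (L * (Fᵀ * F)⁻¹ * Fᵀ).mulVec e = g ∧
      √(e ⬝ᵥ e) ≤ √c * (√(g ⬝ᵥ g) * √(eigMax (c⁻¹ • (Fᵀ * F))) / √(eigMin (L * Lᵀ))) := by
  have hl := hL.eigMin_pos
  set u := (L * Lᵀ)⁻¹.mulVec g with hu
  set v := Lᵀ.mulVec u with hv
  have hug : (L * Lᵀ).mulVec u = g := by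
    rw [hu, mulVec_mulVec, Matrix.mul_nonsing_inv _ hL.det_pos.ne'.isUnit, one_mulVec]
  have hvv : v ⬝ᵥ v = u ⬝ᵥ g := by
    conv_lhs => enter [1]; rw [hv, mulVec_transpose]
    rw [← dotProduct_mulVec, hv, mulVec_mulVec, hug]
  have hvg : eigMin (L * Lᵀ) * (v ⬝ᵥ v) ≤ 1 * (g ⬝ᵥ g) := by
    refine mul_le_mul_of_sq_le_mul hl zero_le_one (dotProduct_self_nonneg v)
      (dotProduct_self_nonneg g) (hvv ▸ dotProduct_sq_le u g) ?_
    have h := eigMin_mul_dotProduct_self_le (L * Lᵀ) u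
    rwa [hug, ← hvv, ← one_mul (v ⬝ᵥ v)] at h
  refine ⟨F.mulVec v, ?_, ?_⟩
  · rw [mulVec_mulVec, Matrix.mul_assoc, Matrix.mul_assoc, Matrix.nonsing_inv_mul _ hF,
      Matrix.mul_one, hv, mulVec_mulVec, hug]
  have hee : F.mulVec v ⬝ᵥ F.mulVec v = c * (v ⬝ᵥ (c⁻¹ • (Fᵀ * F)).mulVec v) := by
    rw [smul_mulVec, dotProduct_smul, smul_eq_mul, mul_inv_cancel_left₀ hc.ne', ← mulVec_mulVec,
      dotProduct_mulVec v, vecMul_transpose]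
  have hmax := dotProduct_mulVec_le_eigMax_mul (c⁻¹ • (Fᵀ * F)) v
  rw [hee, Real.sqrt_mul hc.le]
  refine mul_le_mul_of_nonneg_left ?_ (Real.sqrt_nonneg c)
  rw [mul_comm √(g ⬝ᵥ g), mul_div_assoc, ← Real.sqrt_div (dotProduct_self_nonneg g)]
  calc √(v ⬝ᵥ (c⁻¹ • (Fᵀ * F)).mulVec v)
      ≤ √(eigMax (c⁻¹ • (Fᵀ * F)) * (v ⬝ᵥ v)) := Real.sqrt_le_sqrt hmax
    _ = √(eigMax (c⁻¹ • (Fᵀ * F))) * √(v ⬝ᵥ v) := Real.sqrt_mul' _ (dotProduct_self_nonneg v)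
    _ ≤ √(eigMax (c⁻¹ • (Fᵀ * F))) * √(g ⬝ᵥ g / eigMin (L * Lᵀ)) := by
      gcongr
      rw [le_div_iff₀' hl]
      simpa using hvg

end Weighted

theorem standardized_bias_bound
    (T P R n : ℕ) (hT : 0 < T) (hP : 0 < P) (hR : 0 < R) (hn : 0 < n)
    (Ψ : Matrix (Fin T) (Fin P) ℝ) (hΨ : IsUnit (Ψᵀ * Ψ).det)
    (Ψt : Matrix (Fin R) (Fin P) ℝ) (hΨt : (Ψt * Ψtᵀ).PosDef)
    (Sb : Matrix (Fin T) (Fin T) ℝ) (hSb : Sb.PosDef)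
    (V : Matrix (Fin R) (Fin R) ℝ)
    (hV : V = (n : ℝ)⁻¹ • (Ψt * (Ψᵀ * Ψ)⁻¹ * Ψᵀ * Sb * Ψ * (Ψᵀ * Ψ)⁻¹ * Ψtᵀ))
    (hVpd : V.PosDef)
    -- `A = V^{-1/2}`: the symmetric positive definite square root of `V⁻¹`
    (A : Matrix (Fin R) (Fin R) ℝ) (hA : A.PosDef) (hAV : V * (A * A) = 1) :
    (∀ (d : Fin T → ℝ) (g : Fin R → ℝ),
      Real.sqrt ((A.mulVec ((Ψt * (Ψᵀ * Ψ)⁻¹ * Ψᵀ).mulVec d - g)) ⬝ᵥ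
          (A.mulVec ((Ψt * (Ψᵀ * Ψ)⁻¹ * Ψᵀ).mulVec d - g))) ≤
        Real.sqrt ((n : ℝ) * (T : ℝ) / eigMin Sb) *
          ((⨆ t, |d t|) +
            Real.sqrt (g ⬝ᵥ g) * Real.sqrt (eigMax ((T : ℝ)⁻¹ • (Ψᵀ * Ψ))) /
              Real.sqrt (eigMin (Ψt * Ψtᵀ)))) ∧
    -- In particular: with `d` the vector of approximation errors whose sup-norm is
    -- bounded by `Nsup = ‖f - f_{P,0}‖_∞` and `g = Γ(f - f_{P,0})` with
    -- `‖g‖ ≤ C₃ · Nsob = C₃ · |f - f_{P,0}|_s`, this yields the bias bound of the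
    -- asymptotic normality theorem.
    (∀ (d : Fin T → ℝ) (g : Fin R → ℝ) (Nsup Nsob C3 : ℝ),
      (⨆ t, |d t|) ≤ Nsup → Real.sqrt (g ⬝ᵥ g) ≤ C3 * Nsob →
      Real.sqrt ((A.mulVec ((Ψt * (Ψᵀ * Ψ)⁻¹ * Ψᵀ).mulVec d - g)) ⬝ᵥ
          (A.mulVec ((Ψt * (Ψᵀ * Ψ)⁻¹ * Ψᵀ).mulVec d - g))) ≤
        Real.sqrt ((n : ℝ) * (T : ℝ) / eigMin Sb) *
          (Nsup +
            C3 * Nsob * Real.sqrt (eigMax ((T : ℝ)⁻¹ • (Ψᵀ * Ψ))) /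
              Real.sqrt (eigMin (Ψt * Ψtᵀ)))) := by
  have main (d : Fin T → ℝ) (g : Fin R → ℝ) :
      Real.sqrt ((A.mulVec ((Ψt * (Ψᵀ * Ψ)⁻¹ * Ψᵀ).mulVec d - g)) ⬝ᵥ
          (A.mulVec ((Ψt * (Ψᵀ * Ψ)⁻¹ * Ψᵀ).mulVec d - g))) ≤
        Real.sqrt ((n : ℝ) * (T : ℝ) / eigMin Sb) *
          ((⨆ t, |d t|) +
            Real.sqrt (g ⬝ᵥ g) * Real.sqrt (eigMax ((T : ℝ)⁻¹ • (Ψᵀ * Ψ))) /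
              Real.sqrt (eigMin (Ψt * Ψtᵀ))) := by
    have : Nonempty (Fin T) := ⟨⟨0, hT⟩⟩
    have : Nonempty (Fin R) := ⟨⟨0, hR⟩⟩
    have hn' : (0 : ℝ) < n := Nat.cast_pos.mpr hn
    have hT' : (0 : ℝ) < T := Nat.cast_pos.mpr hT
    obtain ⟨e, he, hle⟩ := exists_preimage_sieve_functional Ψ hΨ hΨt hT' g
    have hAC :
        (n : ℝ)⁻¹ • ((Ψt * (Ψᵀ * Ψ)⁻¹ * Ψᵀ) * Sb * (Ψt * (Ψᵀ * Ψ)⁻¹ * Ψᵀ)ᵀ) * (A * A) = 1 := by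
      rw [← hAV, hV]
      simp only [transpose_mul, transpose_nonsing_inv, transpose_transpose, Matrix.mul_assoc]
    have hAt : Aᵀ = A := by simpa using hA.isHermitian.eq
    have hd := sqrt_dotProduct_self_le_sqrt_card_mul_iSup d
    rw [Fintype.card_fin] at hd
    conv_lhs => rw [← he, ← mulVec_sub]
    refine (sqrt_dotProduct_standardized_le hSb _ hAt hn' hAC (d - e)).trans ?_
    rw [mul_div_right_comm, Real.sqrt_mul' _ hT'.le, mul_assoc]
    refine mul_le_mul_of_nonneg_left ?_ (Real.sqrt_nonneg _)
    rw [mul_add]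
    exact (sqrt_dotProduct_self_sub_le d e).trans (add_le_add hd hle)
  refine ⟨main, fun d g Nsup Nsob C3 hd hg ↦ (main d g).trans ?_⟩
  gcongr
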